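/- Let B0 be an [n,t] linear code over a field F and let k be an integer with 1 ≤ k ≤ n − t, and let g_k(B0) denote the k-th gap of B0. Then every subset S of {1,…,n} with |S| = g_k(B0) contains a subset S' with |S'| = k such that S' is a k-core of B0. -/

import Mathlib

open Classical in
/-- The support of a vector: the set of coordinates where it is nonzero. -/
noncomputable def vsupp {F : Type*} [Field F] {n : ℕ} (v : Fin n → F) : Finset (Fin n) :=
  Finset.univ.filter (fun i => v i ≠ 0)

open Classical in
/-- The support of a subspace: the union of the supports of its vectors. -/
noncomputable def codeSupp {F : Type*} [Field F] {n : ℕ}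
    (D : Submodule F (Fin n → F)) : Finset (Fin n) :=
  Finset.univ.filter (fun i => ∃ v ∈ D, v i ≠ 0)

/-- The dual code w.r.t. the standard bilinear form `⟨x,y⟩ = ∑ x i * y i`. -/
def dualCode {F : Type*} [Field F] {n : ℕ} (C : Submodule F (Fin n → F)) :
    Submodule F (Fin n → F) where
  carrier := {w | ∀ v ∈ C, ∑ i, v i * w i = 0}
  zero_mem' := by intro v _; simp
  add_mem' := by
    intro a b ha hb v hv
    have h : ∑ i, v i * (a + b) i = (∑ i, v i * a i) + ∑ i, v i * b i := by
      simp [mul_add, Finset.sum_add_distrib]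
    rw [h, ha v hv, hb v hv, add_zero]
  smul_mem' := by
    intro c a ha v hv
    have h : ∑ i, v i * (c • a) i = c * ∑ i, v i * a i := by
      simp [Finset.mul_sum, mul_left_comm]
    rw [h, ha v hv, mul_zero]

/-- The `i`-th generalized Hamming weight (1-indexed): the minimum support cardinality
of an `i`-dimensional subspace. -/
noncomputable def ghw {F : Type*} [Field F] {n : ℕ} (C : Submodule F (Fin n → F)) (i : ℕ) : ℕ :=
  sInf {s | ∃ D : Submodule F (Fin n → F), D ≤ C ∧ Module.finrank F D = i ∧ (codeSupp D).card = s}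

/-- The set of gaps of a code: elements of `{1,…,n}` that are not generalized Hamming weights. -/
noncomputable def gapSet {F : Type*} [Field F] {n : ℕ} (C : Submodule F (Fin n → F)) : Finset ℕ :=
  (Finset.Icc 1 n) \ ((Finset.Icc 1 (Module.finrank F C)).image (ghw C))

/-- The `i`-th gap of a code (1-indexed), via the increasing enumeration of the gap set. -/
noncomputable def gapNum {F : Type*} [Field F] {n : ℕ} (C : Submodule F (Fin n → F)) (i : ℕ) : ℕ :=
  ((gapSet C).sort (· ≤ ·)).getD (i - 1) 0

/-- The minimum distance of a code: the minimum Hamming weight of a nonzero codeword. -/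
noncomputable def dmin {F : Type*} [Field F] {n : ℕ} (C : Submodule F (Fin n → F)) : ℕ :=
  sInf {w | ∃ v ∈ C, v ≠ 0 ∧ (vsupp v).card = w}

/-- `S` is an `ℓ`-core (`ℓ = S.card`) of `B` if no nonzero codeword of `B`
has its support contained in `S`. -/
def isCore {F : Type*} [Field F] {n : ℕ} (B : Submodule F (Fin n → F)) (S : Finset (Fin n)) : Prop :=
  ∀ v ∈ B, v ≠ 0 → ¬ (vsupp v ⊆ S)

/-- The subspace of the dual code spanned by all its codewords of Hamming weight `≤ r+1`. -/
noncomputable def lowWtSpan {F : Type*} [Field F] {n : ℕ}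
    (C : Submodule F (Fin n → F)) (r : ℕ) : Submodule F (Fin n → F) :=
  Submodule.span F {c | c ∈ dualCode C ∧ (vsupp c).card ≤ r + 1}

/-- `A_i`: the set of local parities covering coordinate `i`, i.e. dual codewords of
Hamming weight at most `r+1` whose support contains `i`. -/
def coveringParities {F : Type*} [Field F] {n : ℕ}
    (C : Submodule F (Fin n → F)) (r : ℕ) (i : Fin n) : Set (Fin n → F) :=
  {c | c ∈ dualCode C ∧ (vsupp c).card ≤ r + 1 ∧ c i ≠ 0}

/-- `C` is locally 2-reconstructible with locality `r`: every `A_i` is nonempty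
and `A_i ≠ A_j` for `i ≠ j`. -/
def Locally2Recon {F : Type*} [Field F] {n : ℕ}
    (C : Submodule F (Fin n → F)) (r : ℕ) : Prop :=
  (∀ i : Fin n, (coveringParities C r i).Nonempty) ∧
  (∀ i j : Fin n, i ≠ j → coveringParities C r i ≠ coveringParities C r j)

section GeneralizedWeights

variable {F : Type*} [Field F] {n : ℕ}

lemma mem_codeSupp {D : Submodule F (Fin n → F)} {i : Fin n} :
    i ∈ codeSupp D ↔ ∃ v ∈ D, v i ≠ 0 := by
  simp [codeSupp]

lemma codeSupp_mono {D E : Submodule F (Fin n → F)} (h : D ≤ E) : codeSupp D ⊆ codeSupp E := by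
  intro i hi
  obtain ⟨v, hv, hvi⟩ := mem_codeSupp.1 hi
  exact mem_codeSupp.2 ⟨v, h hv, hvi⟩

/-- The codewords of `D` vanishing at the coordinate `p`. -/
def shorten (D : Submodule F (Fin n → F)) (p : Fin n) : Submodule F (Fin n → F) :=
  D ⊓ LinearMap.ker (LinearMap.proj p : (Fin n → F) →ₗ[F] F)

lemma mem_shorten {D : Submodule F (Fin n → F)} {p : Fin n} {v : Fin n → F} :
    v ∈ shorten D p ↔ v ∈ D ∧ v p = 0 := by
  simp [shorten]

lemma shorten_le (D : Submodule F (Fin n → F)) (p : Fin n) : shorten D p ≤ D :=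
  inf_le_left

lemma notMem_codeSupp_shorten (D : Submodule F (Fin n → F)) (p : Fin n) :
    p ∉ codeSupp (shorten D p) := by
  intro h
  obtain ⟨v, hv, hvp⟩ := mem_codeSupp.1 h
  exact hvp (mem_shorten.1 hv).2

lemma finrank_shorten_add_one {D : Submodule F (Fin n → F)} {p : Fin n} (hp : p ∈ codeSupp D) :
    Module.finrank F (shorten D p) + 1 = Module.finrank F D := by
  let f : Module.Dual F D := (LinearMap.proj p : (Fin n → F) →ₗ[F] F).domRestrict D
  have hf : f ≠ 0 := by
    obtain ⟨v, hv, hvp⟩ := mem_codeSupp.1 hp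
    exact fun h => hvp (LinearMap.congr_fun h ⟨v, hv⟩)
  have hmap : (LinearMap.ker f).map D.subtype = shorten D p := by
    ext v
    simp [f, mem_shorten, and_comm]
  rw [← Module.Dual.finrank_ker_add_one_of_ne_zero hf, ← hmap,
    Submodule.finrank_map_subtype_eq]

lemma codeSupp_nonempty {D : Submodule F (Fin n → F)} (hD : 0 < Module.finrank F D) :
    (codeSupp D).Nonempty := by
  have hne : D ≠ ⊥ := by
    rintro rfl
    simp at hD
  obtain ⟨v, hv, hv0⟩ := D.exists_mem_ne_zero_of_ne_bot hne
  obtain ⟨i, hi⟩ := Function.ne_iff.1 hv0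
  exact ⟨i, mem_codeSupp.2 ⟨v, hv, hi⟩⟩

lemma exists_subcode_finrank_eq (C : Submodule F (Fin n → F)) {i : ℕ}
    (hi : i ≤ Module.finrank F C) :
    ∃ D : Submodule F (Fin n → F), D ≤ C ∧ Module.finrank F D = i := by
  induction hi using Nat.decreasingInduction with
  | self => exact ⟨C, le_rfl, rfl⟩
  | of_succ i _ ih =>
    obtain ⟨D, hDC, hD⟩ := ih
    obtain ⟨p, hp⟩ := codeSupp_nonempty (D := D) (by omega)
    have := finrank_shorten_add_one hp
    exact ⟨shorten D p, (shorten_le D p).trans hDC, by omega⟩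

lemma ghw_le_card_codeSupp {C D : Submodule F (Fin n → F)} (h : D ≤ C) :
    ghw C (Module.finrank F D) ≤ (codeSupp D).card :=
  Nat.sInf_le ⟨D, h, rfl, rfl⟩

lemma exists_card_codeSupp_eq_ghw (C : Submodule F (Fin n → F)) {i : ℕ}
    (hi : i ≤ Module.finrank F C) :
    ∃ D : Submodule F (Fin n → F), D ≤ C ∧ Module.finrank F D = i ∧
      (codeSupp D).card = ghw C i := by
  obtain ⟨D, hDC, hD⟩ := exists_subcode_finrank_eq C hi
  exact Nat.sInf_mem (s := {s | ∃ D : Submodule F (Fin n → F),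
    D ≤ C ∧ Module.finrank F D = i ∧ (codeSupp D).card = s}) ⟨_, D, hDC, hD, rfl⟩

lemma ghw_lt_ghw_succ (C : Submodule F (Fin n → F)) {i : ℕ} (hi : i < Module.finrank F C) :
    ghw C i < ghw C (i + 1) := by
  obtain ⟨D, hDC, hD, hcard⟩ := exists_card_codeSupp_eq_ghw C (Nat.succ_le_of_lt hi)
  obtain ⟨p, hp⟩ := codeSupp_nonempty (D := D) (by omega)
  have hrank : Module.finrank F (shorten D p) = i := by
    have := finrank_shorten_add_one hp
    omega
  calc ghw C i ≤ (codeSupp (shorten D p)).card :=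
        hrank ▸ ghw_le_card_codeSupp ((shorten_le D p).trans hDC)
    _ < (codeSupp D).card := Finset.card_lt_card <|
        (Finset.ssubset_iff_of_subset (codeSupp_mono (shorten_le D p))).2
          ⟨p, hp, notMem_codeSupp_shorten D p⟩
    _ = ghw C (i + 1) := hcard

lemma ghw_strictMonoOn (C : Submodule F (Fin n → F)) :
    StrictMonoOn (ghw C) (Set.Iic (Module.finrank F C)) :=
  strictMonoOn_Iic_of_lt_succ fun _ hi => ghw_lt_ghw_succ C hi

/-- Every code has a set of at most `dim D` coordinates that determine its codewords. -/
lemma exists_determining_set (D : Submodule F (Fin n → F)) :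
    ∃ I : Finset (Fin n), I.card ≤ Module.finrank F D ∧
      ∀ v ∈ D, (∀ i ∈ I, v i = 0) → v = 0 := by
  induction hd : Module.finrank F D generalizing D with
  | zero =>
    refine ⟨∅, by simp, fun v hv _ => ?_⟩
    rwa [Submodule.finrank_eq_zero.1 hd, Submodule.mem_bot] at hv
  | succ d ih =>
    obtain ⟨p, hp⟩ := codeSupp_nonempty (D := D) (by omega)
    have := finrank_shorten_add_one hp
    obtain ⟨I, hI, hdet⟩ := ih (shorten D p) (by omega)
    refine ⟨insert p I, (Finset.card_insert_le _ _).trans (by omega), fun v hv hvI => ?_⟩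
    exact hdet v (mem_shorten.2 ⟨hv, hvI p (Finset.mem_insert_self p I)⟩)
      fun i hi => hvI i (Finset.mem_insert_of_mem hi)

/-- The codewords of `C` whose support is contained in `S`. -/
def supportedSubcode (C : Submodule F (Fin n → F)) (S : Finset (Fin n)) :
    Submodule F (Fin n → F) where
  carrier := {v | v ∈ C ∧ ∀ i ∉ S, v i = 0}
  zero_mem' := ⟨C.zero_mem, fun _ _ => rfl⟩
  add_mem' ha hb := ⟨C.add_mem ha.1 hb.1, fun i hi => by simp [ha.2 i hi, hb.2 i hi]⟩
  smul_mem' c _ ha := ⟨C.smul_mem c ha.1, fun i hi => by simp [ha.2 i hi]⟩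

lemma supportedSubcode_le (C : Submodule F (Fin n → F)) (S : Finset (Fin n)) :
    supportedSubcode C S ≤ C :=
  fun _ hv => hv.1

lemma codeSupp_supportedSubcode_subset (C : Submodule F (Fin n → F)) (S : Finset (Fin n)) :
    codeSupp (supportedSubcode C S) ⊆ S := by
  intro i hi
  obtain ⟨v, hv, hvi⟩ := mem_codeSupp.1 hi
  by_contra h
  exact hvi (hv.2 i h)

lemma eq_zero_of_vsupp_subset {v : Fin n → F} {S : Finset (Fin n)} (h : vsupp v ⊆ S) {i : Fin n}
    (hi : i ∉ S) : v i = 0 := by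
  by_contra hvi
  exact hi (h (by simpa [vsupp] using hvi))

lemma exists_core_of_add_finrank_le (C : Submodule F (Fin n → F)) (S : Finset (Fin n)) {k : ℕ}
    (h : Module.finrank F (supportedSubcode C S) + k ≤ S.card) :
    ∃ S' ⊆ S, S'.card = k ∧ isCore C S' := by
  obtain ⟨I, hI, hdet⟩ := exists_determining_set (supportedSubcode C S)
  have hcard : k ≤ (S \ I).card := by
    have := Finset.le_card_sdiff I S
    omega
  obtain ⟨S', hS', hk⟩ := Finset.exists_subset_card_eq hcard
  refine ⟨S', hS'.trans Finset.sdiff_subset, hk, fun v hv hv0 hsub => hv0 ?_⟩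
  have hsub' := hsub.trans hS'
  exact hdet v
    ⟨hv, fun i hi => eq_zero_of_vsupp_subset hsub' fun h => hi (Finset.mem_sdiff.1 h).1⟩
    fun i hi => eq_zero_of_vsupp_subset hsub' fun h => (Finset.mem_sdiff.1 h).2 hi

lemma le_card_gapSet (C : Submodule F (Fin n → F)) :
    n - Module.finrank F C ≤ (gapSet C).card := by
  have h₁ := Finset.le_card_sdiff ((Finset.Icc 1 (Module.finrank F C)).image (ghw C))
    (Finset.Icc 1 n)
  have h₂ := Finset.card_image_le (s := Finset.Icc 1 (Module.finrank F C)) (f := ghw C)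
  rw [Nat.card_Icc] at h₁ h₂
  unfold gapSet
  omega

/-- At least `k` elements of `s` are bounded by the `k`-th smallest element. -/
lemma le_card_filter_le_sort_getD (s : Finset ℕ) {k : ℕ} (hk1 : 1 ≤ k) (hk : k ≤ s.card) :
    k ≤ (s.filter (· ≤ (s.sort (· ≤ ·)).getD (k - 1) 0)).card := by
  have hlen : (s.sort (· ≤ ·)).length = s.card := s.length_sort _
  rw [List.getD_eq_getElem _ _ (by omega)]
  have hmono := s.sortedLT_sort.strictMono_get
  have hinj : Function.Injective
      fun j : Fin k => (s.sort (· ≤ ·)).get ⟨j, by omega⟩ := fun a b hab => by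
    simpa [Fin.ext_iff] using hmono.injective hab
  calc k = (Finset.univ.image
        fun j : Fin k => (s.sort (· ≤ ·)).get ⟨j, by omega⟩).card := by
        rw [Finset.card_image_of_injective _ hinj, Finset.card_fin]
    _ ≤ _ := Finset.card_le_card fun x hx => by
        obtain ⟨j, -, rfl⟩ := Finset.mem_image.1 hx
        refine Finset.mem_filter.2 ⟨(Finset.mem_sort _).1 (List.get_mem _ _), ?_⟩
        exact hmono.monotone (Fin.mk_le_mk.2 (by omega))

lemma finrank_supportedSubcode_add_le (C : Submodule F (Fin n → F)) {S : Finset (Fin n)} {k : ℕ}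
    (hk1 : 1 ≤ k) (hk : k ≤ n - Module.finrank F C) (hS : S.card = gapNum C k) :
    Module.finrank F (supportedSubcode C S) + k ≤ S.card := by
  set m := Module.finrank F (supportedSubcode C S)
  have hmC : m ≤ Module.finrank F C := Submodule.finrank_mono (supportedSubcode_le C S)
  have hmS : ghw C m ≤ S.card := (ghw_le_card_codeSupp (supportedSubcode_le C S)).trans
    (Finset.card_le_card (codeSupp_supportedSubcode_subset C S))
  have hmono := ghw_strictMonoOn C
  let W := (Finset.Icc 1 m).image (ghw C)
  let G := (gapSet C).filter (· ≤ S.card)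
  have hW : W.card = m := by
    rw [Finset.card_image_of_injOn, Nat.card_Icc, Nat.add_sub_cancel]
    exact hmono.injOn.mono fun i hi => (Finset.mem_Icc.1 hi).2.trans hmC
  have hG : k ≤ G.card := by
    simpa only [G, hS, gapNum] using
      le_card_filter_le_sort_getD (gapSet C) hk1 (hk.trans (le_card_gapSet C))
  have hdisj : Disjoint W G := by
    refine Finset.disjoint_left.2 fun x hxW hxG => ?_
    have hx := (Finset.mem_sdiff.1 (Finset.mem_filter.1 hxG).1).2
    exact hx (Finset.image_subset_image (Finset.Icc_subset_Icc_right hmC) hxW)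
  have hsub : W ∪ G ⊆ Finset.Icc 1 S.card := by
    refine Finset.union_subset (fun x hx => ?_) fun x hx => ?_
    · obtain ⟨i, hi, rfl⟩ := Finset.mem_image.1 hx
      obtain ⟨hi1, him⟩ := Finset.mem_Icc.1 hi
      have hpos : ghw C 0 < ghw C i := hmono (Nat.zero_le _) (him.trans hmC) hi1
      exact Finset.mem_Icc.2
        ⟨by omega, (hmono.monotoneOn (him.trans hmC) hmC him).trans hmS⟩
    · obtain ⟨hxg, hxS⟩ := Finset.mem_filter.1 hx
      exact Finset.mem_Icc.2 ⟨(Finset.mem_Icc.1 (Finset.mem_sdiff.1 hxg).1).1, hxS⟩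
  have hcard := Finset.card_le_card hsub
  rw [Finset.card_union_of_disjoint hdisj, Nat.card_Icc] at hcard
  omega

end GeneralizedWeights

/-- any set `S` of size `g_k(B0)` contains a subset `S'` of size `k`
which is a `k`-core of `B0`. -/
theorem stmt5 {F : Type*} [Field F] {n t k : ℕ}
    (B0 : Submodule F (Fin n → F)) (ht : Module.finrank F B0 = t)
    (hk1 : 1 ≤ k) (hkt : k ≤ n - t) :
    ∀ S : Finset (Fin n), S.card = gapNum B0 k →
      ∃ S' : Finset (Fin n), S' ⊆ S ∧ S'.card = k ∧ isCore B0 S' := by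
  subst ht
  intro S hS
  exact exists_core_of_add_finrank_le B0 S (finrank_supportedSubcode_add_le B0 hk1 hkt hS)
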